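/- Let p, k be arbitrary symmetric 2-tensors on ℝ^{1+3}, Ψ = (Ψ_k), Φ = (Φ_k) arbitrary m-tuples of scalars, and Π, Θ arbitrary 2-tensors or scalars. Then there is a universal constant C such that pointwise: |P(p,k,Ψ,Φ)| ≤ C(|p|_{𝒯𝒰}|k|_{𝒯𝒰} + |p|_{ℒℒ}|k|_{𝒰𝒰} + |p|_{𝒰𝒰}|k|_{ℒℒ} + |p|_{𝒯𝒰}|Ψ|_𝒦 + |Ψ|_𝒦|Φ|_𝒦), and |Q(∂Π,∂Θ)| ≤ C(|∂̄Π||∂Θ| + |∂Π||∂̄Θ|). -/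

import Mathlib

noncomputable section

open MeasureTheory

namespace LR

/-- Spacetime point in `ℝ^{1+3}`; coordinate `0` is time. -/
abbrev Pt := Fin 4 → ℝ

/-- A 2-tensor field on spacetime. -/
abbrev Tsr := Pt → Fin 4 → Fin 4 → ℝ

/-- Minkowski metric `diag(-1,1,1,1)` (the components of `m` and of `m⁻¹` coincide). -/
def mink (μ ν : Fin 4) : ℝ := if μ = ν then (if μ = 0 then -1 else 1) else 0

/-- Partial derivative `∂_μ`. -/
def pd (μ : Fin 4) (f : Pt → ℝ) (p : Pt) : ℝ := fderiv ℝ f p (Pi.single μ 1)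

/-- Directional derivative along a vector `U`. -/
def dirD (U : Pt) (f : Pt → ℝ) (p : Pt) : ℝ := fderiv ℝ f p U

/-- Spatial radius `r = |x|`. -/
def rad (p : Pt) : ℝ := Real.sqrt ((p 1)^2 + (p 2)^2 + (p 3)^2)

/-- `q = r - t`. -/
def qc (p : Pt) : ℝ := rad p - p 0

/-- The null vector `L = (1, x/r)`. -/
def Lv (p : Pt) : Pt := fun μ => if μ = 0 then 1 else p μ / rad p

/-- The null vector `L̄ = (1, -x/r)`. -/
def Lbv (p : Pt) : Pt := fun μ => if μ = 0 then 1 else -(p μ / rad p)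

/-- Spatial dot product of two spacetime vectors. -/
def sdot (X Y : Pt) : ℝ := X 1 * Y 1 + X 2 * Y 2 + X 3 * Y 3

/-- `S₁, S₂` is an admissible orthonormal pair tangent to the sphere through `p`. -/
structure SphFrame (p : Pt) (S₁ S₂ : Pt) : Prop where
  time1 : S₁ 0 = 0
  time2 : S₂ 0 = 0
  unit1 : sdot S₁ S₁ = 1
  unit2 : sdot S₂ S₂ = 1
  orth : sdot S₁ S₂ = 0
  rad1 : sdot S₁ p = 0
  rad2 : sdot S₂ p = 0

/-- The family 𝒰 = {L, L̄, S₁, S₂}. -/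
def Ufam (p S₁ S₂ : Pt) : List Pt := [Lv p, Lbv p, S₁, S₂]
/-- The family 𝒯 = {L, S₁, S₂}. -/
def Tfam (p S₁ S₂ : Pt) : List Pt := [Lv p, S₁, S₂]
/-- The family ℒ = {L}. -/
def Lfam (p : Pt) : List Pt := [Lv p]

/-- Contraction of a pointwise 2-tensor with two vectors. -/
def tcon (π : Fin 4 → Fin 4 → ℝ) (V W : Pt) : ℝ := ∑ μ, ∑ ν, π μ ν * V μ * W ν

/-- Seminorm `|π|_{𝒱𝒲}` of a pointwise 2-tensor. -/
def semi (π : Fin 4 → Fin 4 → ℝ) (Vs Ws : List Pt) : ℝ :=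
  (Vs.map fun V => (Ws.map fun W => |tcon π V W|).sum).sum

/-- Derivative seminorm `|∂π|_{𝒱𝒲}` with derivative directions from `Ds`. -/
def dsemi (π : Tsr) (Ds Vs Ws : List Pt) (p : Pt) : ℝ :=
  (Ds.map fun U => (Vs.map fun V => (Ws.map fun W =>
    |∑ μ, ∑ ν, dirD U (fun y => π y μ ν) p * V μ * W ν|).sum).sum).sum

/-- `|ψ|_𝒦`. -/
def ksemi {m : ℕ} (ψ : Fin m → ℝ) : ℝ := ∑ k, |ψ k|

/-- `|∂ψ|_𝒦` with derivative directions from `Ds`. -/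
def kdsemi {m : ℕ} (ψ : Fin m → Pt → ℝ) (Ds : List Pt) (p : Pt) : ℝ :=
  (Ds.map fun U => ∑ k, |dirD U (ψ k) p|).sum

/-- Sum of `|∂u|` over a family of directions. -/
def dAll (Ds : List Pt) (u : Pt → ℝ) (p : Pt) : ℝ := (Ds.map fun U => |dirD U u p|).sum

/-- Lowering both indices of a contravariant 2-tensor with the Minkowski metric. -/
def lowT (H : Tsr) : Tsr := fun p μ ν => ∑ ρ, ∑ σ, mink μ ρ * mink ν σ * H p ρ σ

/-- `1 + t + |q|`. -/
def Aw (p : Pt) : ℝ := 1 + p 0 + |qc p|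
/-- `1 + |q|`. -/
def Bw (p : Pt) : ℝ := 1 + |qc p|

/-- The null form `Q₀(∂u, ∂v) = m^{μν} ∂_μ u ∂_ν v`. -/
def Q0f (u v : Pt → ℝ) (p : Pt) : ℝ := ∑ μ, ∑ ν, mink μ ν * pd μ u p * pd ν v p

/-- The null form `Q̃_{αβ}(∂u, ∂v) = ∂_α u ∂_β v - ∂_β u ∂_α v`. -/
def Qtf (α β : Fin 4) (u v : Pt → ℝ) (p : Pt) : ℝ :=
  pd α u p * pd β v p - pd β u p * pd α v p

/-- `P¹(p,k) = m^{ρσ}m^{λτ}(¼ p_{ρσ}k_{λτ} - ½ p_{ρλ}k_{στ})` on pointwise tensors. -/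
def P1v (pT kT : Fin 4 → Fin 4 → ℝ) : ℝ :=
  ∑ ρ, ∑ σ, ∑ lam, ∑ τ, mink ρ σ * mink lam τ *
    ((1/4) * pT ρ σ * kT lam τ - (1/2) * pT ρ lam * kT σ τ)

/-- `P²(p,Ψ) = N^k m^{ρσ}(p_{ρσ}Ψ_k + Ψ_k p_{ρσ})`. -/
def P2v {m : ℕ} (N : Fin m → ℝ) (pT : Fin 4 → Fin 4 → ℝ) (Ψ : Fin m → ℝ) : ℝ :=
  ∑ k, N k * ∑ ρ, ∑ σ, mink ρ σ * (pT ρ σ * Ψ k + Ψ k * pT ρ σ)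

/-- `P³(Ψ,Φ) = N^{kl}(Ψ_kΦ_l + Φ_lΨ_k)`. -/
def P3v {m : ℕ} (NN : Fin m → Fin m → ℝ) (Ψ Φ : Fin m → ℝ) : ℝ :=
  ∑ k, ∑ l, NN k l * (Ψ k * Φ l + Φ l * Ψ k)

lemma mink_eq_frame {p S₁ S₂ : Pt} (hr : 0 < rad p) (hS : SphFrame p S₁ S₂) (μ ν : Fin 4) :
    mink μ ν = -(1/2) * (Lv p μ * Lbv p ν + Lbv p μ * Lv p ν) + S₁ μ * S₁ ν + S₂ μ * S₂ ν := by
  have hsq : rad p ^ 2 = (p 1)^2 + (p 2)^2 + (p 3)^2 := Real.sq_sqrt (by positivity)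
  obtain ⟨t1, t2, u1, u2, o, r1, r2⟩ := hS
  simp only [sdot] at u1 u2 o r1 r2
  have hne := hr.ne'
  let M : Matrix (Fin 3) (Fin 3) ℝ :=
    !![p 1 / rad p, p 2 / rad p, p 3 / rad p; S₁ 1, S₁ 2, S₁ 3; S₂ 1, S₂ 2, S₂ 3]
  have hM : M * M.transpose = 1 := by
    ext i j
    fin_cases i <;> fin_cases j <;>
      simp [M, Matrix.mul_apply, Fin.sum_univ_three] <;> field_simp <;> linarith
  have hM' : M.transpose * M = 1 := mul_eq_one_comm.mp hM
  have key : ∀ i j : Fin 3, p i.succ / rad p * (p j.succ / rad p) + S₁ i.succ * S₁ j.succ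
      + S₂ i.succ * S₂ j.succ = if i = j then 1 else 0 := by
    intro i j
    have h := congrFun (congrFun hM' i) j
    rw [Matrix.one_apply] at h
    rw [← h]
    fin_cases i <;> fin_cases j <;>
      simp [M, Matrix.mul_apply, Fin.sum_univ_three]
  induction μ using Fin.cases with
  | zero =>
    induction ν using Fin.cases with
    | zero => simp [mink, Lv, Lbv, t1, t2]; norm_num
    | succ j => simp [mink, Lv, Lbv, t1, t2, (Fin.succ_ne_zero j).symm]
  | succ i =>
    induction ν using Fin.cases with
    | zero => simp [mink, Lv, Lbv, t1, t2]
    | succ j =>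
      have h := key i j
      simp only [mink, Lv, Lbv, Fin.succ_ne_zero, Fin.succ_inj, if_false]
      rw [← h]
      ring

lemma tcon_comm {π : Fin 4 → Fin 4 → ℝ} (h : ∀ μ ν, π μ ν = π ν μ) (V W : Pt) :
    tcon π V W = tcon π W V := by
  unfold tcon
  rw [Finset.sum_comm]
  refine Finset.sum_congr rfl fun μ _ => Finset.sum_congr rfl fun ν _ => ?_
  rw [h]
  ring

lemma tcon_add (π θ : Fin 4 → Fin 4 → ℝ) (V W : Pt) :
    tcon (fun μ ν => π μ ν + θ μ ν) V W = tcon π V W + tcon θ V W := by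
  simp only [tcon, add_mul, Finset.sum_add_distrib]

lemma tcon_const_mul (c : ℝ) (π : Fin 4 → Fin 4 → ℝ) (V W : Pt) :
    tcon (fun μ ν => c * π μ ν) V W = c * tcon π V W := by
  simp only [tcon, mul_assoc, Finset.mul_sum]

lemma tcon_mul (a b : Fin 4 → ℝ) (V W : Pt) :
    tcon (fun μ ν => a μ * b ν) V W = (∑ μ, a μ * V μ) * ∑ ν, b ν * W ν := by
  rw [tcon, Finset.sum_mul_sum]
  refine Finset.sum_congr rfl fun μ _ => Finset.sum_congr rfl fun ν _ => ?_
  ring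

lemma sum_sum_mul_eq_tcon (π : Fin 4 → Fin 4 → ℝ) (V W : Pt) :
    ∑ μ, (∑ ν, π μ ν * W ν) * V μ = tcon π V W := by
  unfold tcon
  simp only [Finset.sum_mul]
  refine Finset.sum_congr rfl fun μ _ => Finset.sum_congr rfl fun ν _ => ?_
  ring

/-- Contracting with the Minkowski metric in a null frame. -/
lemma sum_mink_mul {p S₁ S₂ : Pt} (hr : 0 < rad p) (hS : SphFrame p S₁ S₂)
    (π : Fin 4 → Fin 4 → ℝ) :
    ∑ μ, ∑ ν, mink μ ν * π μ ν =
      -(1/2) * (tcon π (Lv p) (Lbv p) + tcon π (Lbv p) (Lv p))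
        + tcon π S₁ S₁ + tcon π S₂ S₂ := by
  simp only [tcon, Finset.mul_sum, ← Finset.sum_add_distrib]
  refine Finset.sum_congr rfl fun μ _ => Finset.sum_congr rfl fun ν _ => ?_
  rw [mink_eq_frame hr hS]
  ring

/-- The double contraction `m^{ρσ} m^{λτ} p_{ρλ} k_{στ}` in a null frame. -/
lemma sum_mink_mink_mul {p S₁ S₂ : Pt} (hr : 0 < rad p) (hS : SphFrame p S₁ S₂)
    (π θ : Fin 4 → Fin 4 → ℝ) :
    ∑ ρ, ∑ σ, mink ρ σ * ∑ lam, ∑ τ, mink lam τ * (π ρ lam * θ σ τ) =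
      (let g : Pt → Pt → ℝ := fun V W =>
        -(1/2) * (tcon π V (Lv p) * tcon θ W (Lbv p) + tcon π V (Lbv p) * tcon θ W (Lv p))
          + tcon π V S₁ * tcon θ W S₁ + tcon π V S₂ * tcon θ W S₂;
      -(1/2) * (g (Lv p) (Lbv p) + g (Lbv p) (Lv p)) + g S₁ S₁ + g S₂ S₂) := by
  simp only [sum_mink_mul hr hS, tcon_mul, tcon_add, tcon_const_mul, sum_sum_mul_eq_tcon]

lemma P1v_eq (π θ : Fin 4 → Fin 4 → ℝ) :
    P1v π θ = 1/4 * ((∑ ρ, ∑ σ, mink ρ σ * π ρ σ) * ∑ lam, ∑ τ, mink lam τ * θ lam τ)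
      - 1/2 * ∑ ρ, ∑ σ, mink ρ σ * ∑ lam, ∑ τ, mink lam τ * (π ρ lam * θ σ τ) := by
  simp only [P1v, Finset.sum_mul]
  simp only [Finset.mul_sum, ← Finset.sum_sub_distrib]
  refine Finset.sum_congr rfl fun ρ _ => Finset.sum_congr rfl fun σ _ =>
    Finset.sum_congr rfl fun lam _ => Finset.sum_congr rfl fun τ _ => ?_
  ring

lemma le_sum_map_of_mem {α : Type*} {l : List α} {f : α → ℝ} (hf : ∀ a, 0 ≤ f a) {a : α}
    (ha : a ∈ l) : f a ≤ (l.map f).sum :=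
  List.single_le_sum (by simpa using fun a _ => hf a) _ (List.mem_map_of_mem ha)

lemma sum_map_nonneg_of_nonneg {α : Type*} (l : List α) {f : α → ℝ} (hf : ∀ a, 0 ≤ f a) :
    0 ≤ (l.map f).sum :=
  List.sum_nonneg (by simpa using fun a _ => hf a)

lemma semi_nonneg (π : Fin 4 → Fin 4 → ℝ) (Vs Ws : List Pt) : 0 ≤ semi π Vs Ws :=
  sum_map_nonneg_of_nonneg _ fun _ => sum_map_nonneg_of_nonneg _ fun _ => abs_nonneg _

lemma abs_tcon_le_semi (π : Fin 4 → Fin 4 → ℝ) {Vs Ws : List Pt} {V W : Pt}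
    (hV : V ∈ Vs) (hW : W ∈ Ws) : |tcon π V W| ≤ semi π Vs Ws :=
  (le_sum_map_of_mem (f := fun W => |tcon π V W|) (fun _ => abs_nonneg _) hW).trans
    (le_sum_map_of_mem (f := fun V => (Ws.map fun W => |tcon π V W|).sum)
      (fun _ => sum_map_nonneg_of_nonneg _ fun _ => abs_nonneg _) hV)

lemma ksemi_nonneg {m : ℕ} (ψ : Fin m → ℝ) : 0 ≤ ksemi ψ :=
  Finset.sum_nonneg fun _ _ => abs_nonneg _

lemma abs_le_ksemi {m : ℕ} (ψ : Fin m → ℝ) (k : Fin m) : |ψ k| ≤ ksemi ψ :=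
  Finset.single_le_sum (f := fun k => |ψ k|) (fun _ _ => abs_nonneg _) (Finset.mem_univ k)

lemma abs_trace_le {p S₁ S₂ : Pt} (hr : 0 < rad p) (hS : SphFrame p S₁ S₂)
    {π : Fin 4 → Fin 4 → ℝ} (h : ∀ μ ν, π μ ν = π ν μ) :
    |∑ μ, ∑ ν, mink μ ν * π μ ν| ≤ 3 * semi π (Tfam p S₁ S₂) (Ufam p S₁ S₂) := by
  rw [sum_mink_mul hr hS, tcon_comm h (Lbv p)]
  have a : ∀ V ∈ Tfam p S₁ S₂, ∀ W ∈ Ufam p S₁ S₂, _ :=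
    fun V hV W hW => abs_le.mp (abs_tcon_le_semi π hV hW)
  have h1 := a (Lv p) (by simp [Tfam]) (Lbv p) (by simp [Ufam])
  have h2 := a S₁ (by simp [Tfam]) S₁ (by simp [Ufam])
  have h3 := a S₂ (by simp [Tfam]) S₂ (by simp [Ufam])
  rw [abs_le]
  constructor <;> linarith

lemma abs_mul_le_mul {a b A B : ℝ} (ha : |a| ≤ A) (hb : |b| ≤ B) : |a * b| ≤ A * B := by
  rw [abs_mul]
  exact mul_le_mul ha hb (abs_nonneg _) ((abs_nonneg _).trans ha)

lemma abs_P1v_le {p S₁ S₂ : Pt} (hr : 0 < rad p) (hS : SphFrame p S₁ S₂)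
    {π θ : Fin 4 → Fin 4 → ℝ} (hπ : ∀ μ ν, π μ ν = π ν μ) (hθ : ∀ μ ν, θ μ ν = θ ν μ) :
    |P1v π θ| ≤ 10 * (semi π (Tfam p S₁ S₂) (Ufam p S₁ S₂) *
          semi θ (Tfam p S₁ S₂) (Ufam p S₁ S₂)
        + semi π (Lfam p) (Lfam p) * semi θ (Ufam p S₁ S₂) (Ufam p S₁ S₂)
        + semi π (Ufam p S₁ S₂) (Ufam p S₁ S₂) * semi θ (Lfam p) (Lfam p)) := by
  have htr := abs_mul_le_mul (abs_trace_le hr hS hπ) (abs_trace_le hr hS hθ)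
  rw [P1v_eq, sum_mink_mink_mul hr hS]
  simp only [tcon_comm hπ (Lbv p) (Lv p), tcon_comm hθ (Lbv p) (Lv p),
    tcon_comm hπ (Lbv p) S₁, tcon_comm hθ (Lbv p) S₁,
    tcon_comm hπ (Lbv p) S₂, tcon_comm hθ (Lbv p) S₂]
  have hL : Lv p ∈ Tfam p S₁ S₂ := by simp [Tfam]
  have h1 : S₁ ∈ Tfam p S₁ S₂ := by simp [Tfam]
  have h2 : S₂ ∈ Tfam p S₁ S₂ := by simp [Tfam]
  have uL : Lv p ∈ Ufam p S₁ S₂ := by simp [Ufam]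
  have uB : Lbv p ∈ Ufam p S₁ S₂ := by simp [Ufam]
  have u1 : S₁ ∈ Ufam p S₁ S₂ := by simp [Ufam]
  have u2 : S₂ ∈ Ufam p S₁ S₂ := by simp [Ufam]
  have lL : Lv p ∈ Lfam p := by simp [Lfam]
  have b : ∀ V ∈ Tfam p S₁ S₂, ∀ W ∈ Ufam p S₁ S₂, ∀ V' ∈ Tfam p S₁ S₂, ∀ W' ∈ Ufam p S₁ S₂, _ :=
    fun V hV W hW V' hV' W' hW' => abs_le.mp
      (abs_mul_le_mul (abs_tcon_le_semi π hV hW) (abs_tcon_le_semi θ hV' hW'))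
  have e1 := abs_le.mp (abs_mul_le_mul (abs_tcon_le_semi π lL lL) (abs_tcon_le_semi θ uB uB))
  have e2 := abs_le.mp (abs_mul_le_mul (abs_tcon_le_semi π uB uB) (abs_tcon_le_semi θ lL lL))
  have e3 := b _ hL _ uB _ hL _ uB
  have f1 := b _ hL _ u1 _ h1 _ uB
  have f2 := b _ hL _ u2 _ h2 _ uB
  have f3 := b _ h1 _ uB _ hL _ u1
  have f4 := b _ h2 _ uB _ hL _ u2
  have f5 := b _ h1 _ uL _ h1 _ uB
  have f6 := b _ h2 _ uL _ h2 _ uB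
  have f7 := b _ h1 _ uB _ h1 _ uL
  have f8 := b _ h2 _ uB _ h2 _ uL
  have g1 := b _ h1 _ u1 _ h1 _ u1
  have g2 := b _ h1 _ u2 _ h1 _ u2
  have g3 := b _ h2 _ u1 _ h2 _ u1
  have g4 := b _ h2 _ u2 _ h2 _ u2
  have htr := abs_le.mp htr
  rw [abs_le]
  constructor <;> nlinarith only [htr.1, htr.2, e1.1, e1.2, e2.1, e2.2, e3.1, e3.2, f1.1, f1.2,
    f2.1, f2.2, f3.1, f3.2, f4.1, f4.2, f5.1, f5.2, f6.1, f6.2, f7.1, f7.2, f8.1, f8.2,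
    g1.1, g1.2, g2.1, g2.2, g3.1, g3.2, g4.1, g4.2]

lemma abs_P2v_le {m : ℕ} (N : Fin m → ℝ) {p S₁ S₂ : Pt} (hr : 0 < rad p) (hS : SphFrame p S₁ S₂)
    {π : Fin 4 → Fin 4 → ℝ} (hπ : ∀ μ ν, π μ ν = π ν μ) (Ψ : Fin m → ℝ) :
    |P2v N π Ψ| ≤ 6 * (∑ k, |N k|) * (semi π (Tfam p S₁ S₂) (Ufam p S₁ S₂) * ksemi Ψ) := by
  have htr := abs_trace_le hr hS hπ
  have heq : P2v N π Ψ = ∑ k, N k * (2 * ((∑ μ, ∑ ν, mink μ ν * π μ ν) * Ψ k)) := by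
    unfold P2v
    refine Finset.sum_congr rfl fun k _ => ?_
    congr 1
    simp only [Finset.sum_mul, Finset.mul_sum]
    refine Finset.sum_congr rfl fun μ _ => Finset.sum_congr rfl fun ν _ => ?_
    ring
  rw [heq, Finset.mul_sum, Finset.sum_mul]
  refine (Finset.abs_sum_le_sum_abs _ _).trans (Finset.sum_le_sum fun k _ => ?_)
  have h := abs_mul_le_mul htr (abs_le_ksemi Ψ k)
  rw [abs_mul, abs_mul, abs_two]
  nlinarith [abs_nonneg (N k)]

lemma abs_P3v_le {m : ℕ} (NN : Fin m → Fin m → ℝ) (Ψ Φ : Fin m → ℝ) :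
    |P3v NN Ψ Φ| ≤ 2 * (∑ k, ∑ l, |NN k l|) * (ksemi Ψ * ksemi Φ) := by
  unfold P3v
  simp only [Finset.mul_sum, Finset.sum_mul]
  refine (Finset.abs_sum_le_sum_abs _ _).trans (Finset.sum_le_sum fun k _ =>
    (Finset.abs_sum_le_sum_abs _ _).trans (Finset.sum_le_sum fun l _ => ?_))
  have h := abs_mul_le_mul (abs_le_ksemi Ψ k) (abs_le_ksemi Φ l)
  rw [show NN k l * (Ψ k * Φ l + Φ l * Ψ k) = NN k l * (2 * (Ψ k * Φ l)) by ring, abs_mul,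
    abs_mul, abs_two]
  nlinarith [abs_nonneg (NN k l)]

lemma dAll_nonneg (Ds : List Pt) (u : Pt → ℝ) (p : Pt) : 0 ≤ dAll Ds u p :=
  sum_map_nonneg_of_nonneg _ fun _ => abs_nonneg _

lemma abs_dirD_le_dAll {Ds : List Pt} {V : Pt} (hV : V ∈ Ds) (u : Pt → ℝ) (p : Pt) :
    |dirD V u p| ≤ dAll Ds u p :=
  le_sum_map_of_mem (f := fun V => |dirD V u p|) (fun _ => abs_nonneg _) hV

lemma dAll_Tfam_le_dAll_Ufam (p S₁ S₂ : Pt) (u : Pt → ℝ) :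
    dAll (Tfam p S₁ S₂) u p ≤ dAll (Ufam p S₁ S₂) u p := by
  simp only [dAll, Tfam, Ufam, List.map_cons, List.map_nil, List.sum_cons, List.sum_nil]
  linarith [abs_nonneg (dirD (Lbv p) u p)]

lemma sum_pd_mul (u : Pt → ℝ) (p V : Pt) : ∑ μ, pd μ u p * V μ = dirD V u p := by
  unfold pd dirD
  conv_rhs => rw [← Finset.univ_sum_single V, map_sum]
  refine Finset.sum_congr rfl fun μ _ => ?_
  rw [show (Pi.single μ (V μ) : Pt) = V μ • Pi.single μ 1 by
    rw [← Pi.single_smul, smul_eq_mul, mul_one], map_smul, smul_eq_mul, mul_comm]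

lemma abs_Q0f_le {p S₁ S₂ : Pt} (hr : 0 < rad p) (hS : SphFrame p S₁ S₂) (u v : Pt → ℝ) :
    |Q0f u v p| ≤ 4 * (dAll (Tfam p S₁ S₂) u p * dAll (Ufam p S₁ S₂) v p
        + dAll (Ufam p S₁ S₂) u p * dAll (Tfam p S₁ S₂) v p) := by
  have h := sum_mink_mul hr hS fun μ ν => pd μ u p * pd ν v p
  simp only [tcon_mul, sum_pd_mul, ← mul_assoc] at h
  rw [Q0f, h]
  have hL : Lv p ∈ Tfam p S₁ S₂ := by simp [Tfam]
  have h1 : S₁ ∈ Tfam p S₁ S₂ := by simp [Tfam]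
  have h2 : S₂ ∈ Tfam p S₁ S₂ := by simp [Tfam]
  have uB : Lbv p ∈ Ufam p S₁ S₂ := by simp [Ufam]
  have u1 : S₁ ∈ Ufam p S₁ S₂ := by simp [Ufam]
  have u2 : S₂ ∈ Ufam p S₁ S₂ := by simp [Ufam]
  have e1 := abs_le.mp (abs_mul_le_mul (abs_dirD_le_dAll hL u p) (abs_dirD_le_dAll uB v p))
  have e2 := abs_le.mp (abs_mul_le_mul (abs_dirD_le_dAll uB u p) (abs_dirD_le_dAll hL v p))
  have e3 := abs_le.mp (abs_mul_le_mul (abs_dirD_le_dAll h1 u p) (abs_dirD_le_dAll u1 v p))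
  have e4 := abs_le.mp (abs_mul_le_mul (abs_dirD_le_dAll h2 u p) (abs_dirD_le_dAll u2 v p))
  rw [abs_le]
  constructor <;> nlinarith only [e1.1, e1.2, e2.1, e2.2, e3.1, e3.2, e4.1, e4.2]

lemma pd_eq_mink_mul (α : Fin 4) (u : Pt → ℝ) (p : Pt) :
    pd α u p = mink α α * ∑ σ, pd σ u p * mink α σ := by
  rw [Finset.sum_eq_single α (fun b _ hb => by simp [mink, hb.symm]) (by simp)]
  by_cases h : α = 0 <;> simp [mink, h]

lemma abs_Lv_le_one {p : Pt} (hr : 0 < rad p) (α : Fin 4) : |Lv p α| ≤ 1 := by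
  have hsq : rad p ^ 2 = (p 1)^2 + (p 2)^2 + (p 3)^2 := Real.sq_sqrt (by positivity)
  by_cases h : α = 0
  · simp [Lv, h]
  · simp only [Lv, h, if_false]
    rw [abs_div, abs_of_pos hr, div_le_one hr]
    refine abs_le_of_sq_le_sq (hsq ▸ ?_) hr.le
    fin_cases α
    · exact absurd rfl h
    all_goals
      simp
      nlinarith [sq_nonneg (p 1), sq_nonneg (p 2), sq_nonneg (p 3)]

lemma abs_Lbv_eq (p : Pt) (α : Fin 4) : |Lbv p α| = |Lv p α| := by
  by_cases h : α = 0 <;> simp [Lv, Lbv, h]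

lemma abs_le_one_of_unit {S : Pt} (h0 : S 0 = 0) (h1 : sdot S S = 1) (α : Fin 4) :
    |S α| ≤ 1 := by
  simp only [sdot] at h1
  refine abs_le_of_sq_le_sq ?_ zero_le_one
  fin_cases α
  · simp [h0]
  · change S 1 ^ 2 ≤ 1 ^ 2
    nlinarith [sq_nonneg (S 2), sq_nonneg (S 3)]
  · change S 2 ^ 2 ≤ 1 ^ 2
    nlinarith [sq_nonneg (S 1), sq_nonneg (S 3)]
  · change S 3 ^ 2 ≤ 1 ^ 2
    nlinarith [sq_nonneg (S 1), sq_nonneg (S 2)]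

/-- Up to derivatives tangent to the cone, every coordinate derivative is a multiple of the
derivative in the direction of `L̄`. -/
lemma abs_pd_sub_le {p S₁ S₂ : Pt} (hr : 0 < rad p) (hS : SphFrame p S₁ S₂) (α : Fin 4)
    (u : Pt → ℝ) :
    |pd α u p - -(1/2) * mink α α * Lv p α * dirD (Lbv p) u p| ≤ dAll (Tfam p S₁ S₂) u p := by
  have heq : pd α u p - -(1/2) * mink α α * Lv p α * dirD (Lbv p) u p =
      mink α α * (-(1/2) * (Lbv p α * dirD (Lv p) u p) + S₁ α * dirD S₁ u p
        + S₂ α * dirD S₂ u p) := by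
    rw [pd_eq_mink_mul]
    have : ∑ σ, pd σ u p * mink α σ = -(1/2) * (Lv p α * dirD (Lbv p) u p
        + Lbv p α * dirD (Lv p) u p) + S₁ α * dirD S₁ u p + S₂ α * dirD S₂ u p := by
      simp only [← sum_pd_mul, Finset.mul_sum, ← Finset.sum_add_distrib]
      refine Finset.sum_congr rfl fun σ _ => ?_
      rw [mink_eq_frame hr hS]
      ring
    rw [this]
    ring
  have hm : |mink α α| = 1 := by by_cases h : α = 0 <;> simp [mink, h]
  rw [heq, abs_mul, hm, one_mul]
  have e1 := abs_le.mp (abs_mul_le_mul ((abs_Lbv_eq p α).trans_le (abs_Lv_le_one hr α))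
    (le_refl |dirD (Lv p) u p|))
  have e2 := abs_le.mp (abs_mul_le_mul (abs_le_one_of_unit hS.time1 hS.unit1 α)
    (le_refl |dirD S₁ u p|))
  have e3 := abs_le.mp (abs_mul_le_mul (abs_le_one_of_unit hS.time2 hS.unit2 α)
    (le_refl |dirD S₂ u p|))
  have := abs_nonneg (dirD (Lv p) u p)
  simp only [dAll, Tfam, List.map_cons, List.map_nil, List.sum_cons, List.sum_nil]
  rw [abs_le]
  constructor <;> linarith

lemma abs_Qtf_le {p S₁ S₂ : Pt} (hr : 0 < rad p) (hS : SphFrame p S₁ S₂) (α β : Fin 4)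
    (u v : Pt → ℝ) :
    |Qtf α β u v p| ≤ 4 * (dAll (Tfam p S₁ S₂) u p * dAll (Ufam p S₁ S₂) v p
        + dAll (Ufam p S₁ S₂) u p * dAll (Tfam p S₁ S₂) v p) := by
  set c : Fin 4 → ℝ := fun α => -(1/2) * mink α α * Lv p α with hc
  have hc1 : ∀ α, |c α| ≤ 1 := by
    intro α
    have hm : |mink α α| = 1 := by by_cases h : α = 0 <;> simp [mink, h]
    have hL := abs_Lv_le_one hr α
    simp only [hc]
    rw [abs_mul, abs_mul, hm]
    norm_num
    linarith
  set w : (Pt → ℝ) → Fin 4 → ℝ := fun f α => pd α f p - c α * dirD (Lbv p) f p with hw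
  have hw1 : ∀ f α, |w f α| ≤ dAll (Tfam p S₁ S₂) f p := fun f α => abs_pd_sub_le hr hS α f
  have heq : Qtf α β u v p = w u α * w v β - w u β * w v α
      + c α * (dirD (Lbv p) u p * w v β) - c β * (dirD (Lbv p) u p * w v α)
      + c β * (w u α * dirD (Lbv p) v p) - c α * (w u β * dirD (Lbv p) v p) := by
    simp only [Qtf, hw]
    ring
  have uB : Lbv p ∈ Ufam p S₁ S₂ := by simp [Ufam]
  have hu := abs_dirD_le_dAll uB u p
  have hv := abs_dirD_le_dAll uB v p
  have hT := dAll_Tfam_le_dAll_Ufam p S₁ S₂ v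
  have e1 := abs_le.mp (abs_mul_le_mul (hw1 u α) ((hw1 v β).trans hT))
  have e2 := abs_le.mp (abs_mul_le_mul (hw1 u β) ((hw1 v α).trans hT))
  have e3 := abs_le.mp (abs_mul_le_mul (hc1 α) (abs_mul_le_mul hu (hw1 v β)))
  have e4 := abs_le.mp (abs_mul_le_mul (hc1 β) (abs_mul_le_mul hu (hw1 v α)))
  have e5 := abs_le.mp (abs_mul_le_mul (hc1 β) (abs_mul_le_mul (hw1 u α) hv))
  have e6 := abs_le.mp (abs_mul_le_mul (hc1 α) (abs_mul_le_mul (hw1 u β) hv))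
  have n := mul_nonneg (dAll_nonneg (Ufam p S₁ S₂) u p) (dAll_nonneg (Tfam p S₁ S₂) v p)
  rw [heq, abs_le]
  constructor <;> linarith

/-- modified Lemma 4.2 of Lindblad–Rodnianski: pointwise estimates
for the quadratic form `P(p,k,Ψ,Φ) = P¹(p,k) + P²(p,Ψ) + P³(Ψ,Φ)` and for any linear
combination `Q` of the null forms `Q₀` and `Q̃_{αβ}`. -/
theorem stmt_4 (m : ℕ) (N : Fin m → ℝ) (NN : Fin m → Fin m → ℝ)
    (cq0 : ℝ) (cqt : Fin 4 → Fin 4 → ℝ) :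
    ∃ C : ℝ, 0 < C ∧
      ∀ (p S₁ S₂ : Pt), 0 < rad p → SphFrame p S₁ S₂ →
        ((∀ (pT kT : Fin 4 → Fin 4 → ℝ),
            (∀ μ ν, pT μ ν = pT ν μ) → (∀ μ ν, kT μ ν = kT ν μ) →
            ∀ (Ψ Φ : Fin m → ℝ),
            |P1v pT kT + P2v N pT Ψ + P3v NN Ψ Φ| ≤
              C * (semi pT (Tfam p S₁ S₂) (Ufam p S₁ S₂) *
                      semi kT (Tfam p S₁ S₂) (Ufam p S₁ S₂)
                + semi pT (Lfam p) (Lfam p) * semi kT (Ufam p S₁ S₂) (Ufam p S₁ S₂)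
                + semi pT (Ufam p S₁ S₂) (Ufam p S₁ S₂) * semi kT (Lfam p) (Lfam p)
                + semi pT (Tfam p S₁ S₂) (Ufam p S₁ S₂) * ksemi Ψ
                + ksemi Ψ * ksemi Φ))
          ∧ (∀ (Pfn Tfn : Pt → ℝ), DifferentiableAt ℝ Pfn p → DifferentiableAt ℝ Tfn p →
              |cq0 * Q0f Pfn Tfn p + ∑ α, ∑ β, cqt α β * Qtf α β Pfn Tfn p| ≤
                C * (dAll (Tfam p S₁ S₂) Pfn p * dAll (Ufam p S₁ S₂) Tfn p
                  + dAll (Ufam p S₁ S₂) Pfn p * dAll (Tfam p S₁ S₂) Tfn p))) := by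
  have hA : 0 ≤ ∑ k, |N k| := Finset.sum_nonneg fun _ _ => abs_nonneg _
  have hB : 0 ≤ ∑ k, ∑ l, |NN k l| :=
    Finset.sum_nonneg fun _ _ => Finset.sum_nonneg fun _ _ => abs_nonneg _
  have hD : 0 ≤ ∑ α, ∑ β, |cqt α β| :=
    Finset.sum_nonneg fun _ _ => Finset.sum_nonneg fun _ _ => abs_nonneg _
  have hc := abs_nonneg cq0
  obtain ⟨C, hC⟩ : ∃ C, C = 10 + 6 * (∑ k, |N k|) + 2 * (∑ k, ∑ l, |NN k l|) + 4 * |cq0|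
    + 4 * ∑ α, ∑ β, |cqt α β| := ⟨_, rfl⟩
  refine ⟨C, by linarith, fun p S₁ S₂ hr hS => ⟨?_, ?_⟩⟩
  · intro pT kT hp hk Ψ Φ
    have h1 := abs_P1v_le hr hS hp hk
    have h2 := abs_P2v_le N hr hS hp Ψ
    have h3 := abs_P3v_le NN Ψ Φ
    have n1 := mul_nonneg (semi_nonneg pT (Tfam p S₁ S₂) (Ufam p S₁ S₂))
      (semi_nonneg kT (Tfam p S₁ S₂) (Ufam p S₁ S₂))
    have n2 := mul_nonneg (semi_nonneg pT (Lfam p) (Lfam p))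
      (semi_nonneg kT (Ufam p S₁ S₂) (Ufam p S₁ S₂))
    have n3 := mul_nonneg (semi_nonneg pT (Ufam p S₁ S₂) (Ufam p S₁ S₂))
      (semi_nonneg kT (Lfam p) (Lfam p))
    have n4 := mul_nonneg (semi_nonneg pT (Tfam p S₁ S₂) (Ufam p S₁ S₂)) (ksemi_nonneg Ψ)
    have n5 := mul_nonneg (ksemi_nonneg Ψ) (ksemi_nonneg Φ)
    have c1 := h1.trans (mul_le_mul_of_nonneg_right (show 10 ≤ C by linarith)
      (add_nonneg (add_nonneg n1 n2) n3))
    have c2 := h2.trans (mul_le_mul_of_nonneg_right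
      (show 6 * (∑ k, |N k|) ≤ C by linarith) n4)
    have c3 := h3.trans (mul_le_mul_of_nonneg_right
      (show 2 * (∑ k, ∑ l, |NN k l|) ≤ C by linarith) n5)
    refine (abs_add_three _ _ _).trans ((add_le_add (add_le_add c1 c2) c3).trans_eq ?_)
    ring
  · intro u v _ _
    have h0 := abs_Q0f_le hr hS u v
    set X := dAll (Tfam p S₁ S₂) u p * dAll (Ufam p S₁ S₂) v p
      + dAll (Ufam p S₁ S₂) u p * dAll (Tfam p S₁ S₂) v p with hX
    have hX0 : 0 ≤ X := add_nonneg (mul_nonneg (dAll_nonneg _ _ _) (dAll_nonneg _ _ _))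
      (mul_nonneg (dAll_nonneg _ _ _) (dAll_nonneg _ _ _))
    have ht : |∑ α, ∑ β, cqt α β * Qtf α β u v p| ≤ (∑ α, ∑ β, |cqt α β|) * (4 * X) := by
      simp only [Finset.sum_mul]
      exact (Finset.abs_sum_le_sum_abs _ _).trans (Finset.sum_le_sum fun α _ =>
        (Finset.abs_sum_le_sum_abs _ _).trans (Finset.sum_le_sum fun β _ =>
          abs_mul_le_mul le_rfl (abs_Qtf_le hr hS α β u v)))
    have hq := abs_mul_le_mul (le_refl |cq0|) h0
    refine (abs_add_le _ _).trans ((add_le_add hq ht).trans ?_)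
    have := mul_le_mul_of_nonneg_right
      (show 4 * |cq0| + 4 * (∑ α, ∑ β, |cqt α β|) ≤ C by linarith) hX0
    linarith

end LR
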